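/- If μ_n → μ Λ-weakly for some μ ∈ Λ(ℝ^d), then the sequence {μ_n} is Λ-tight. -/

import Mathlib

open MeasureTheory Filter Topology Set ENNReal

noncomputable section

abbrev Ed (d : ℕ) : Type := EuclideanSpace ℝ (Fin d)

/-- A Lévy measure on a normed space: it assigns zero mass to `{0}` and
integrates `min {1, ‖x‖²}`. -/
def IsLevyMeasure {E : Type*} [NormedAddCommGroup E] [MeasurableSpace E]
    (μ : Measure E) : Prop :=
  μ {0} = 0 ∧ (∫⁻ x, ENNReal.ofReal (min 1 (‖x‖ ^ 2)) ∂μ) ≠ ⊤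

/-- Finite (global) second moment. -/
def HasFiniteSecondMoment {E : Type*} [NormedAddCommGroup E] [MeasurableSpace E]
    (μ : Measure E) : Prop :=
  (∫⁻ x, ENNReal.ofReal (‖x‖ ^ 2) ∂μ) ≠ ⊤

/-- A Lévy coupling of `μ` and `ν`: a Lévy measure on the product whose marginals
agree with `μ`, `ν` on all measurable sets not containing a neighbourhood of `0`. -/
def IsLevyCoupling {E : Type*} [NormedAddCommGroup E] [MeasurableSpace E]
    (μ ν : Measure E) (γ : Measure (E × E)) : Prop :=
  IsLevyMeasure γ ∧
    ∀ s : Set E, MeasurableSet s → s ∉ nhds (0 : E) →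
      γ (s ×ˢ (univ : Set E)) = μ s ∧ γ ((univ : Set E) ×ˢ s) = ν s

/-- The 2-optimal Lévy transport cost `C₂^Λ(μ,ν)`. -/
noncomputable def levyTransportCost {E : Type*} [NormedAddCommGroup E] [MeasurableSpace E]
    (μ ν : Measure E) : ℝ≥0∞ :=
  ⨅ (γ : Measure (E × E)) (_ : IsLevyCoupling μ ν γ),
    ∫⁻ p, ENNReal.ofReal (‖p.1 - p.2‖ ^ 2 / 2) ∂γ

/-- Λ-weak convergence of Lévy measures. -/
def LevyWeakTendsto {E : Type*} [NormedAddCommGroup E] [MeasurableSpace E]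
    (μs : ℕ → Measure E) (μ : Measure E) : Prop :=
  ∀ φ : E → ℝ, Continuous φ →
    (∃ C : ℝ, 0 ≤ C ∧ ∀ x, |φ x| ≤ C * min 1 (‖x‖ ^ 2)) →
    Tendsto (fun n => ∫ x, φ x ∂μs n) atTop (𝓝 (∫ x, φ x ∂μ))

/-- Λ-tightness of a family of Lévy measures. -/
def LevyTight {E : Type*} [NormedAddCommGroup E] [MeasurableSpace E]
    (M : Set (Measure E)) : Prop :=
  (⨆ μ ∈ M, ∫⁻ x, ENNReal.ofReal (min 1 (‖x‖ ^ 2)) ∂μ) ≠ ⊤ ∧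
    ∀ ε : ℝ≥0∞, 0 < ε →
      ∃ K : Set E, IsCompact K ∧ (0 : E) ∉ K ∧
        (⨆ μ ∈ M, ∫⁻ x in Kᶜ, ENNReal.ofReal (min 1 (‖x‖ ^ 2)) ∂μ) < ε

/-- The integrand `min {1, ‖x‖²}` defining Lévy measures. -/
def levyWeight {E : Type*} [NormedAddCommGroup E] (x : E) : ℝ := min 1 (‖x‖ ^ 2)

/-- The annulus `{x | 1 / (k + 1) ≤ ‖x‖ ≤ k + 1}`. -/
def levyAnnulus (E : Type*) [NormedAddCommGroup E] (k : ℕ) : Set E :=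
  {x | 1 ≤ ((k : ℝ) + 1) * ‖x‖ ∧ ‖x‖ ≤ (k : ℝ) + 1}

/-- A continuous cutoff with values in `[0, 1]`, equal to one off `levyAnnulus E k`. -/
def levyCutoff {E : Type*} [NormedAddCommGroup E] (k : ℕ) (x : E) : ℝ :=
  max 0 (min 1 (max (2 - ((k : ℝ) + 1) * ‖x‖) (‖x‖ - k)))

section

variable {E : Type*} [NormedAddCommGroup E]

lemma continuous_levyWeight : Continuous (levyWeight : E → ℝ) := by
  unfold levyWeight; fun_prop

lemma levyWeight_nonneg (x : E) : 0 ≤ levyWeight x := by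
  unfold levyWeight; positivity

lemma continuous_levyCutoff (k : ℕ) : Continuous (levyCutoff k : E → ℝ) := by
  unfold levyCutoff; fun_prop

lemma levyCutoff_nonneg (k : ℕ) (x : E) : 0 ≤ levyCutoff k x := le_max_left _ _

lemma levyCutoff_le_one (k : ℕ) (x : E) : levyCutoff k x ≤ 1 :=
  max_le zero_le_one (min_le_left _ _)

lemma levyCutoff_eq_one {k : ℕ} {x : E} (hx : x ∉ levyAnnulus E k) : levyCutoff k x = 1 := by
  have h1 : 1 ≤ max (2 - ((k : ℝ) + 1) * ‖x‖) (‖x‖ - k) := by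
    by_contra! hlt
    obtain ⟨h1, h2⟩ := max_lt_iff.1 hlt
    exact hx ⟨by linarith, by linarith⟩
  rw [levyCutoff, min_eq_left h1, max_eq_right zero_le_one]

lemma eventually_levyCutoff_eq_zero {x : E} (hx : x ≠ 0) :
    ∀ᶠ k : ℕ in atTop, levyCutoff k x = 0 := by
  have hpos : 0 < ‖x‖ := norm_pos_iff.2 hx
  filter_upwards [tendsto_natCast_atTop_atTop.eventually_ge_atTop (2 / ‖x‖),
    tendsto_natCast_atTop_atTop.eventually_ge_atTop ‖x‖] with k h1 h2
  rw [div_le_iff₀ hpos] at h1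
  exact max_eq_left ((min_le_right _ _).trans (max_le (by nlinarith) (by linarith)))

lemma levyAnnulus_mono : Monotone (levyAnnulus E) := by
  intro j k hjk x hx
  have hcast : (j : ℝ) ≤ k := Nat.cast_le.2 hjk
  exact ⟨hx.1.trans (by gcongr), hx.2.trans (by linarith)⟩

lemma isClosed_levyAnnulus (k : ℕ) : IsClosed (levyAnnulus E k) :=
  (isClosed_le continuous_const (continuous_const.mul continuous_norm)).inter
    (isClosed_le continuous_norm continuous_const)

lemma isCompact_levyAnnulus [ProperSpace E] (k : ℕ) : IsCompact (levyAnnulus E k) :=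
  (isCompact_closedBall (0 : E) ((k : ℝ) + 1)).of_isClosed_subset (isClosed_levyAnnulus k)
    fun _ hx => mem_closedBall_zero_iff.2 hx.2

lemma zero_notMem_levyAnnulus (k : ℕ) : (0 : E) ∉ levyAnnulus E k := fun hx => by
  have := hx.1
  norm_num at this

variable [MeasurableSpace E] [BorelSpace E]

lemma IsLevyMeasure.integrable_levyWeight {μ : Measure E} (hμ : IsLevyMeasure μ) :
    Integrable levyWeight μ :=
  (lintegral_ofReal_ne_top_iff_integrable
    continuous_levyWeight.measurable.aestronglyMeasurable
    (Eventually.of_forall levyWeight_nonneg)).1 hμ.2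

/-- Along a Λ-weakly convergent sequence, the lower integrals of nonnegative test functions
converge. -/
lemma LevyWeakTendsto.tendsto_lintegral {μs : ℕ → Measure E} {μ : Measure E}
    (h : ∀ n, IsLevyMeasure (μs n)) (hμ : IsLevyMeasure μ) (hconv : LevyWeakTendsto μs μ)
    {φ : E → ℝ} (hφ : Continuous φ) (hφ0 : ∀ x, 0 ≤ φ x) (hφw : ∀ x, φ x ≤ levyWeight x) :
    Tendsto (fun n => ∫⁻ x, ENNReal.ofReal (φ x) ∂μs n) atTop
      (𝓝 (∫⁻ x, ENNReal.ofReal (φ x) ∂μ)) := by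
  have key : ∀ ν : Measure E, IsLevyMeasure ν →
      ∫⁻ x, ENNReal.ofReal (φ x) ∂ν = ENNReal.ofReal (∫ x, φ x ∂ν) := fun ν hν =>
    (ofReal_integral_eq_lintegral_ofReal
      (hν.integrable_levyWeight.mono' hφ.measurable.aestronglyMeasurable
        (Eventually.of_forall fun x => by
          rw [Real.norm_of_nonneg (hφ0 x)]; exact hφw x))
      (Eventually.of_forall hφ0)).symm
  rw [key μ hμ]
  simp_rw [fun n => key (μs n) (h n)]
  refine (ENNReal.continuous_ofReal.tendsto _).comp (hconv φ hφ ⟨1, zero_le_one, fun x => ?_⟩)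
  rw [abs_of_nonneg (hφ0 x), one_mul]
  exact hφw x

/-- The cutoff integrals of a single Lévy measure vanish in the limit. -/
lemma IsLevyMeasure.tendsto_lintegral_levyCutoff {μ : Measure E} (hμ : IsLevyMeasure μ) :
    Tendsto (fun k => ∫⁻ x, ENNReal.ofReal (levyCutoff k x * levyWeight x) ∂μ) atTop (𝓝 0) := by
  rw [← lintegral_zero (μ := μ)]
  refine tendsto_lintegral_of_dominated_convergence
    (fun x => ENNReal.ofReal (levyWeight x)) (fun k => ?_) (fun k => ?_) hμ.2 ?_
  · exact ((continuous_levyCutoff k).mul continuous_levyWeight).measurable.ennreal_ofReal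
  · exact Eventually.of_forall fun x => ENNReal.ofReal_le_ofReal
      (mul_le_of_le_one_left (levyWeight_nonneg x) (levyCutoff_le_one k x))
  · have hne : ∀ᵐ x ∂μ, x ≠ 0 := measure_eq_zero_iff_ae_notMem.1 hμ.1
    filter_upwards [hne] with x hx
    refine tendsto_const_nhds.congr' ?_
    filter_upwards [eventually_levyCutoff_eq_zero hx] with k hk
    simp [hk]

lemma setLIntegral_compl_levyAnnulus_le (ν : Measure E) (k : ℕ) :
    ∫⁻ x in (levyAnnulus E k)ᶜ, ENNReal.ofReal (levyWeight x) ∂ν ≤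
      ∫⁻ x, ENNReal.ofReal (levyCutoff k x * levyWeight x) ∂ν :=
  calc
    _ = ∫⁻ x in (levyAnnulus E k)ᶜ, ENNReal.ofReal (levyCutoff k x * levyWeight x) ∂ν :=
      setLIntegral_congr_fun (isClosed_levyAnnulus k).measurableSet.compl fun x hx => by
        simp only [levyCutoff_eq_one hx, one_mul]
    _ ≤ _ := setLIntegral_le_lintegral _ _

/-- A Λ-weakly convergent sequence of Lévy measures on a proper space is Λ-tight. -/
lemma LevyWeakTendsto.levyTight_range [ProperSpace E] {μs : ℕ → Measure E} {μ : Measure E}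
    (h : ∀ n, IsLevyMeasure (μs n)) (hμ : IsLevyMeasure μ) (hconv : LevyWeakTendsto μs μ) :
    LevyTight (Set.range μs) := by
  refine ⟨?_, fun ε hε => ?_⟩
  · have hbdd : Bornology.IsBounded (range fun n => ∫ x, levyWeight x ∂μs n) :=
      Metric.isBounded_range_of_tendsto _ (hconv levyWeight continuous_levyWeight
        ⟨1, zero_le_one, fun x => by
          rw [abs_of_nonneg (levyWeight_nonneg x), one_mul, levyWeight]⟩)
    obtain ⟨B, hB⟩ := hbdd.bddAbove
    rw [iSup_range]
    refine ne_top_of_le_ne_top (ENNReal.ofReal_ne_top (r := B)) (iSup_le fun n => ?_)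
    refine (ofReal_integral_eq_lintegral_ofReal (h n).integrable_levyWeight
      (Eventually.of_forall levyWeight_nonneg)).ge.trans ?_
    exact ENNReal.ofReal_le_ofReal (hB (mem_range_self n))
  · obtain ⟨δ, hδ, hδε⟩ := exists_between hε
    have hsmall : ∀ {ν : Measure E}, IsLevyMeasure ν → ∀ᶠ k in atTop,
        ∫⁻ x, ENNReal.ofReal (levyCutoff k x * levyWeight x) ∂ν < δ := fun hν =>
      hν.tendsto_lintegral_levyCutoff.eventually_lt_const hδ
    obtain ⟨j, hj⟩ := (hsmall hμ).exists
    obtain ⟨N, hN⟩ := eventually_atTop.1 ((hconv.tendsto_lintegral h hμ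
      ((continuous_levyCutoff j).mul continuous_levyWeight)
      (fun x => mul_nonneg (levyCutoff_nonneg j x) (levyWeight_nonneg x))
      (fun x => mul_le_of_le_one_left (levyWeight_nonneg x)
        (levyCutoff_le_one j x))).eventually_lt_const hj)
    have hinit : ∀ᶠ k in atTop, ∀ n ∈ Finset.range N,
        ∫⁻ x, ENNReal.ofReal (levyCutoff k x * levyWeight x) ∂μs n < δ :=
      (Finset.eventually_all _).2 fun n _ => hsmall (h n)
    obtain ⟨k, hk, hjk⟩ := (hinit.and (eventually_ge_atTop j)).exists
    refine ⟨levyAnnulus E k, isCompact_levyAnnulus k, zero_notMem_levyAnnulus k, ?_⟩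
    rw [iSup_range]
    refine (iSup_le fun n => ?_).trans_lt hδε
    rcases lt_or_ge n N with hn | hn
    · exact (setLIntegral_compl_levyAnnulus_le (μs n) k).trans (hk n (Finset.mem_range.2 hn)).le
    · exact (lintegral_mono_set (compl_subset_compl.2 (levyAnnulus_mono hjk))).trans
        ((setLIntegral_compl_levyAnnulus_le (μs n) j).trans (hN n hn).le)

end


/-- A Λ-weakly convergent sequence of Lévy measures is Λ-tight. -/
theorem levyWeakTendsto_levyTight (d : ℕ)
    (μs : ℕ → Measure (Ed d)) (μ : Measure (Ed d))
    (h : ∀ n, IsLevyMeasure (μs n)) (hμ : IsLevyMeasure μ)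
    (hconv : LevyWeakTendsto μs μ) :
    LevyTight (Set.range μs) := by
  exact hconv.levyTight_range h hμ
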